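/- Let n ≥ 3 and fix α > 0. There exists a constant λ ∈ (0,1), depending only on n, p, q, α, such that for every nonnegative Borel measure σ on ℝⁿ, finite on bounded sets, with W_Gσ(x) < ∞ for every x ∈ ℝⁿ, one has W_G( g((W_Gσ)^α)·dσ )(x) ≥ λ · (W_Gσ(x))^(1+α) for every x ∈ ℝⁿ, where g((W_Gσ)^α)·dσ is the measure with density y ↦ g((W_Gσ(y))^α) with respect to σ. -/

import Mathlib

open MeasureTheory Metric Set
open scoped ENNReal

noncomputable def gfun (p q : ℝ) (t : ℝ≥0∞) : ℝ≥0∞ := t ^ (p - 1) + t ^ (q - 1)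

noncomputable def ffun (p q γ : ℝ) (t : ℝ≥0∞) : ℝ≥0∞ :=
  t ^ ((p - 1) * γ) + t ^ ((q - 1) * γ)

noncomputable def Ffun (p q γ : ℝ) (t : ℝ≥0∞) : ℝ≥0∞ :=
  t ^ ((p - 1) * γ + 1) / ENNReal.ofReal ((p - 1) * γ + 1)
    + t ^ ((q - 1) * γ + 1) / ENNReal.ofReal ((q - 1) * γ + 1)

/-- The Wolff-type potential `W_G σ(x) = ∫₀^∞ h(σ(B(x,t))/t^(n−1)) dt`,
where `h` is the inverse of `g`. -/
noncomputable def wolffG (n : ℕ) (h : ℝ≥0∞ → ℝ≥0∞)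
    (σ : Measure (EuclideanSpace ℝ (Fin n))) (x : EuclideanSpace ℝ (Fin n)) : ℝ≥0∞ :=
  ∫⁻ t in Set.Ioi (0 : ℝ), h (σ (ball x t) / ENNReal.ofReal t ^ (n - 1))

/-- The classical Wolff potential `W_s σ(x) = ∫₀^∞ (σ(B(x,t))/t^(n−1))^(1/(s−1)) dt`. -/
noncomputable def wolffS (n : ℕ) (s : ℝ)
    (σ : Measure (EuclideanSpace ℝ (Fin n))) (x : EuclideanSpace ℝ (Fin n)) : ℝ≥0∞ :=
  ∫⁻ t in Set.Ioi (0 : ℝ), (σ (ball x t) / ENNReal.ofReal t ^ (n - 1)) ^ (1 / (s - 1))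

/-- Condition (A) on the measure σ. -/
def condA (n : ℕ) (p q γ : ℝ) (σ : Measure (EuclideanSpace ℝ (Fin n))) : Prop :=
  ∀ s ∈ ({p, q} : Set ℝ),
    ∀ θ ∈ ({1 / (1 - γ), (p - 1) / (p - 1 - γ * (q - 1)),
            (q - 1) / (q - 1 - γ * (p - 1))} : Set ℝ),
      (∫⁻ x, Ffun p q γ ((wolffS n s σ x) ^ θ) ∂σ) < ⊤

theorem gfun_mono {p q : ℝ} (hp : 1 < p) (hpq : p < q) : Monotone (gfun p q) := fun _ _ hst =>
  add_le_add (ENNReal.rpow_le_rpow hst (by linarith)) (ENNReal.rpow_le_rpow hst (by linarith))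

/-- A right inverse of `gfun` which is also a left inverse is monotone. -/
theorem monotone_of_gfun_inverse {p q : ℝ} (hp : 1 < p) (hpq : p < q) {h : ℝ≥0∞ → ℝ≥0∞}
    (hhg : ∀ s, gfun p q (h s) = s) : Monotone h := by
  intro s t hst
  by_contra! hlt
  have hts := gfun_mono hp hpq hlt.le
  rw [hhg, hhg] at hts
  rw [le_antisymm hst hts] at hlt
  exact lt_irrefl _ hlt

theorem gfun_mul_le {p q : ℝ} (hp : 1 < p) (hpq : p < q) (a b : ℝ≥0∞) :
    gfun p q (a * b) ≤ gfun p q a * gfun p q b := by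
  unfold gfun
  rw [ENNReal.mul_rpow_of_nonneg _ _ (by linarith), ENNReal.mul_rpow_of_nonneg _ _ (by linarith),
    add_mul, mul_add, mul_add]
  exact add_le_add le_self_add le_add_self

theorem gfun_const_mul_le {p q : ℝ} (hp : 1 < p) (hpq : p < q) {c : ℝ≥0∞} (hc : c ≤ 1)
    (t : ℝ≥0∞) : gfun p q (c * t) ≤ c ^ (p - 1) * gfun p q t := by
  unfold gfun
  rw [ENNReal.mul_rpow_of_nonneg _ _ (by linarith), ENNReal.mul_rpow_of_nonneg _ _ (by linarith),
    mul_add]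
  exact add_le_add le_rfl
    (mul_le_mul_left (ENNReal.rpow_le_rpow_of_exponent_ge hc (by linarith)) _)

/-- A function of finite integral on the half-line has a median. -/
theorem exists_half_lintegral {f : ℝ → ℝ≥0∞} (hf : Measurable f)
    (hfin : ∫⁻ t in Ioi (0 : ℝ), f t < ⊤) :
    ∃ a : ℝ, 0 ≤ a ∧ (∫⁻ t in Ioc 0 a, f t) = (∫⁻ t in Ioi (0 : ℝ), f t) / 2 ∧
      (∫⁻ t in Ioi a, f t) = (∫⁻ t in Ioi (0 : ℝ), f t) / 2 := by
  have key : ∃ a : ℝ, 0 ≤ a ∧ (∫⁻ t in Ioc 0 a, f t) = (∫⁻ t in Ioi (0 : ℝ), f t) / 2 := by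
    set g : ℝ → ℝ := (Ioi (0 : ℝ)).indicator fun t => (f t).toReal
    have hint : IntegrableOn (fun t => (f t).toReal) (Ioi 0) :=
      integrable_toReal_of_lintegral_ne_top hf.aemeasurable hfin.ne
    have hgi : Integrable g := (integrable_indicator_iff measurableSet_Ioi).2 hint
    have hfae : ∀ᵐ t ∂volume.restrict (Ioi (0 : ℝ)), f t < ⊤ := ae_lt_top hf hfin.ne
    have hI : ∫ t in Ioi (0 : ℝ), g t = (∫⁻ t in Ioi (0 : ℝ), f t).toReal := by
      rw [← integral_toReal hf.aemeasurable hfae]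
      exact setIntegral_congr_fun measurableSet_Ioi fun t ht => indicator_of_mem ht _
    have hG : ∀ a : ℝ, 0 ≤ a → ∫ t in (0 : ℝ)..a, g t = (∫⁻ t in Ioc 0 a, f t).toReal := by
      intro a ha
      rw [intervalIntegral.integral_of_le ha, ← integral_toReal hf.aemeasurable
        (ae_restrict_of_ae_restrict_of_subset Ioc_subset_Ioi_self hfae)]
      exact setIntegral_congr_fun measurableSet_Ioc fun t ht => indicator_of_mem (mem_Ioi.2 ht.1) _
    have hcont : Continuous fun a => ∫ t in (0 : ℝ)..a, g t :=
      intervalIntegral.continuous_primitive (fun _ _ => hgi.intervalIntegrable) 0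
    have hlim := intervalIntegral_tendsto_integral_Ioi (0 : ℝ) hgi.integrableOn Filter.tendsto_id
    obtain ⟨a, ha, haI⟩ : ∃ a : ℝ, 0 ≤ a ∧
        ∫ t in (0 : ℝ)..a, g t = (∫ t in Ioi (0 : ℝ), g t) / 2 := by
      have hI0 : 0 ≤ ∫ t in Ioi (0 : ℝ), g t := hI ▸ ENNReal.toReal_nonneg
      rcases hI0.eq_or_lt with h0 | hpos
      · exact ⟨0, le_rfl, by simp [← h0]⟩
      · obtain ⟨T, hT, hT0⟩ := ((hlim.eventually_const_lt (half_lt_self hpos)).and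
          (Filter.eventually_ge_atTop 0)).exists
        obtain ⟨a, ha, haI⟩ := intermediate_value_Icc hT0 hcont.continuousOn
          ⟨by simpa using (half_pos hpos).le, hT.le⟩
        exact ⟨a, ha.1, haI⟩
    refine ⟨a, ha, ?_⟩
    have hle : ∫⁻ t in Ioc 0 a, f t < ⊤ :=
      (lintegral_mono_set Ioc_subset_Ioi_self).trans_lt hfin
    rw [hG a ha, hI] at haI
    rw [← ENNReal.toReal_eq_toReal_iff' hle.ne (ENNReal.div_lt_top hfin.ne two_ne_zero).ne, haI,
      ENNReal.toReal_div, ENNReal.toReal_ofNat]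
  obtain ⟨a, ha, h1⟩ := key
  refine ⟨a, ha, h1, ?_⟩
  have hsum : (∫⁻ t in Ioi (0 : ℝ), f t) = (∫⁻ t in Ioc 0 a, f t) + ∫⁻ t in Ioi a, f t := by
    rw [← lintegral_union measurableSet_Ioi (Ioc_disjoint_Ioi le_rfl), Ioc_union_Ioi_eq_Ioi ha]
  have hhalf : (∫⁻ t in Ioi (0 : ℝ), f t) / 2 ≠ ⊤ := (ENNReal.div_lt_top hfin.ne two_ne_zero).ne
  refine (ENNReal.add_right_inj hhalf).1 ?_
  rw [ENNReal.add_halves, ← h1]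
  exact hsum.symm

section

variable {n : ℕ} {p q : ℝ} {h : ℝ≥0∞ → ℝ≥0∞}

theorem wolffG_integrand_measurable (hmono : Monotone h)
    (σ : Measure (EuclideanSpace ℝ (Fin n))) (x : EuclideanSpace ℝ (Fin n)) :
    Measurable fun t : ℝ => h (σ (ball x t) / ENNReal.ofReal t ^ (n - 1)) := by
  have hball : Monotone fun t : ℝ => σ (ball x t) := fun s t hst =>
    measure_mono (ball_subset_ball hst)
  exact hmono.measurable.comp (hball.measurable.div (ENNReal.measurable_ofReal.pow_const _))

/-- The tail of the potential at `x` beyond radius `t` is controlled by the potential at any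
point of `B(x,t)`. -/
theorem mul_tail_le_wolffG (hp : 1 < p) (hpq : p < q)
    (hgh : ∀ t, h (gfun p q t) = t) (hhg : ∀ s, gfun p q (h s) = s)
    {c : ℝ≥0∞} (hc1 : c ≤ 1) (hc : c ^ (p - 1) = (2⁻¹ : ℝ≥0∞) ^ (n - 1))
    (σ : Measure (EuclideanSpace ℝ (Fin n))) {x y : EuclideanSpace ℝ (Fin n)} {t : ℝ}
    (hy : y ∈ ball x t) :
    c * ∫⁻ r in Ioi t, h (σ (ball x r) / ENNReal.ofReal r ^ (n - 1)) ≤ wolffG n h σ y := by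
  have hmono := monotone_of_gfun_inverse hp hpq hhg
  have ht : 0 < t := dist_nonneg.trans_lt hy
  set F : ℝ → ℝ≥0∞ := fun s => h (σ (ball y s) / ENNReal.ofReal s ^ (n - 1))
  have hshift : ∫⁻ r in Ioi t, F (r + t) ≤ ∫⁻ s in Ioi (0 : ℝ), F s := by
    have hpre : (fun r : ℝ => r + t) ⁻¹' Ioi (t + t) = Ioi t := by ext r; simp
    have := (measurePreserving_add_right volume t).setLIntegral_comp_preimage
      (measurableSet_Ioi (a := t + t)) (wolffG_integrand_measurable hmono σ y)
    rw [hpre] at this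
    rw [this]
    exact lintegral_mono_set (Ioi_subset_Ioi (by linarith))
  refine le_trans ?_ hshift
  rw [← lintegral_const_mul _ (wolffG_integrand_measurable hmono σ x)]
  refine setLIntegral_mono' measurableSet_Ioi fun r (hr : t < r) => ?_
  rw [← hgh (c * _)]
  refine hmono ((gfun_const_mul_le hp hpq hc1 _).trans ?_)
  rw [hhg, hc, div_eq_mul_inv, div_eq_mul_inv, mul_left_comm, ENNReal.inv_pow, ENNReal.inv_pow,
    ← mul_pow]
  have hdist : dist x y < t := by rw [dist_comm]; exact hy
  gcongr ?_ * ?_ ^ _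
  · exact measure_mono (ball_subset_ball' (by linarith))
  · rw [← ENNReal.mul_inv (Or.inl two_ne_zero) (Or.inl ENNReal.ofNat_ne_top), ENNReal.inv_le_inv,
      ← ENNReal.ofReal_ofNat 2, ← ENNReal.ofReal_mul zero_le_two]
    exact ENNReal.ofReal_le_ofReal (by linarith)

theorem wolffG_withDensity_ge (hp : 1 < p) (hpq : p < q)
    (hgh : ∀ t, h (gfun p q t) = t) (hhg : ∀ s, gfun p q (h s) = s)
    {c : ℝ≥0∞} (hc1 : c ≤ 1) (hc : c ^ (p - 1) = (2⁻¹ : ℝ≥0∞) ^ (n - 1))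
    {α : ℝ} (hα : 0 < α) (σ : Measure (EuclideanSpace ℝ (Fin n)))
    {x : EuclideanSpace ℝ (Fin n)} (hx : wolffG n h σ x < ⊤) :
    (c * (wolffG n h σ x / 2)) ^ α * (wolffG n h σ x / 2) ≤
      wolffG n h (σ.withDensity fun y => gfun p q ((wolffG n h σ y) ^ α)) x := by
  have hmono := monotone_of_gfun_inverse hp hpq hhg
  have hmeas := wolffG_integrand_measurable hmono σ x
  obtain ⟨a, ha, h1, h2⟩ := exists_half_lintegral hmeas hx
  change _ = wolffG n h σ x / 2 at h1 h2
  set M := wolffG n h σ x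
  calc (c * (M / 2)) ^ α * (M / 2)
      = ∫⁻ t in Ioc 0 a, (c * (M / 2)) ^ α * h (σ (ball x t) / ENNReal.ofReal t ^ (n - 1)) := by
        rw [lintegral_const_mul _ hmeas, h1]
    _ ≤ ∫⁻ t in Ioc 0 a, h ((σ.withDensity fun y => gfun p q ((wolffG n h σ y) ^ α)) (ball x t)
          / ENNReal.ofReal t ^ (n - 1)) := by
        refine setLIntegral_mono' measurableSet_Ioc fun t ht => ?_
        rw [← hgh ((c * (M / 2)) ^ α * _)]
        refine hmono ((gfun_mul_le hp hpq _ _).trans ?_)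
        rw [hhg, ← mul_div_assoc, withDensity_apply _ measurableSet_ball, ← setLIntegral_const]
        refine ENNReal.div_le_div_right (setLIntegral_mono' measurableSet_ball fun y hy => ?_) _
        refine gfun_mono hp hpq (ENNReal.rpow_le_rpow ?_ hα.le)
        refine le_trans ?_ (mul_tail_le_wolffG hp hpq hgh hhg hc1 hc σ hy)
        rw [← h2]
        gcongr
        exact ht.2
    _ ≤ _ := lintegral_mono_set Ioc_subset_Ioi_self

end

/-- Lemma (lower Wolff potential iteration estimate):
`W_G(g((W_Gσ)^α) dσ)(x) ≥ λ (W_Gσ(x))^(1+α)`. -/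
theorem wolff_iteration_lower_bound
    (n : ℕ) (hn : 3 ≤ n) (p q : ℝ) (hp : 1 < p) (hpq : p < q)
    (α : ℝ) (hα : 0 < α)
    (h : ℝ≥0∞ → ℝ≥0∞)
    (hgh : ∀ t, h (gfun p q t) = t) (hhg : ∀ s, gfun p q (h s) = s) :
    ∃ lam : ℝ, 0 < lam ∧ lam < 1 ∧
      ∀ σ : Measure (EuclideanSpace ℝ (Fin n)),
        (∀ (x : EuclideanSpace ℝ (Fin n)) (r : ℝ), σ (ball x r) < ⊤) →
        (∀ x, wolffG n h σ x < ⊤) →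
        ∀ x, ENNReal.ofReal lam * (wolffG n h σ x) ^ (1 + α) ≤
          wolffG n h (σ.withDensity fun y => gfun p q ((wolffG n h σ y) ^ α)) x := by
  have hn1 : (0 : ℝ) < (n - 1 : ℕ) := by exact_mod_cast (by omega : 0 < n - 1)
  set c : ℝ := (1 / 2 : ℝ) ^ (((n - 1 : ℕ) : ℝ) / (p - 1)) with hcdef
  have hc0 : 0 < c := by positivity
  have hc1 : c < 1 := Real.rpow_lt_one (by norm_num) (by norm_num) (div_pos hn1 (by linarith))
  have hcp : ENNReal.ofReal c ^ (p - 1) = (2⁻¹ : ℝ≥0∞) ^ (n - 1) := by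
    rw [ENNReal.ofReal_rpow_of_pos hc0, hcdef, ← Real.rpow_mul (by norm_num),
      div_mul_cancel₀ _ (by linarith), Real.rpow_natCast, ENNReal.ofReal_pow (by norm_num), one_div,
      ENNReal.ofReal_inv_of_pos two_pos, ENNReal.ofReal_ofNat]
  clear_value c
  have hcα : c ^ α < 1 := Real.rpow_lt_one hc0.le hc1 hα
  have hhalf : (1 / 2 : ℝ) ^ (1 + α) < 1 :=
    Real.rpow_lt_one (by norm_num) (by norm_num) (by linarith)
  refine ⟨c ^ α * (1 / 2 : ℝ) ^ (1 + α), by positivity,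
    mul_lt_one_of_nonneg_of_lt_one_left (by positivity) hcα hhalf.le, fun σ _ hfin x => ?_⟩
  refine le_trans (le_of_eq ?_) (wolffG_withDensity_ge hp hpq hgh hhg
    (ENNReal.ofReal_le_one.2 hc1.le) hcp hα σ (hfin x))
  rw [ENNReal.ofReal_mul (by positivity), ← ENNReal.ofReal_rpow_of_pos hc0,
    ← ENNReal.ofReal_rpow_of_pos (by norm_num), ENNReal.mul_rpow_of_nonneg _ _ hα.le, mul_assoc,
    mul_assoc, ← ENNReal.mul_rpow_of_nonneg _ _ (by linarith), one_div,
    ENNReal.ofReal_inv_of_pos two_pos, ENNReal.ofReal_ofNat, mul_comm (2⁻¹ : ℝ≥0∞),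
    ← div_eq_mul_inv, add_comm 1 α, ENNReal.rpow_add_of_nonneg _ _ hα.le zero_le_one,
    ENNReal.rpow_one]
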